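/- Let D ≥ 1 and B ≥ 1 be integers and let o, q ∈ ℝ^D be fixed unit vectors. Let P be a random D×D orthogonal matrix distributed according to the Haar probability measure on O(D), let ȳ ∈ 𝒢 be a cosine maximizer of Pᵀo over 𝒢 (for Haar-almost-every P the maximizing unit direction ȳ/‖ȳ‖ is unique and satisfies ⟨Pᵀo, ȳ⟩ > 0, so the following is almost surely well-defined), and set ō := P·ȳ/‖ȳ‖. Then the extended RaBitQ estimator is unbiased: E_P[ ⟨ō, q⟩ / ⟨ō, o⟩ ] = ⟨o, q⟩. -/

import Mathlib

open MeasureTheory Matrix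
open scoped RealInnerProductSpace

noncomputable section

instance (D : ℕ) : MeasurableSpace (Matrix (Fin D) (Fin D) ℝ) := borel _

/-- The grid set `𝒢 ⊆ ℝ^D`: vectors whose coordinates are `−(2^B − 1)/2 + u` for an integer
`u ∈ {0, 1, ..., 2^B − 1}`. -/
def gridSet (D B : ℕ) : Set (EuclideanSpace ℝ (Fin D)) :=
  {y | ∀ i, ∃ u : ℕ, u < 2 ^ B ∧ y i = -((2 ^ B : ℝ) - 1) / 2 + u}

/-- `ȳ ∈ 𝒢` is a cosine maximizer of `o'` over `𝒢` if `⟪ȳ/‖ȳ‖, o'⟫ ≥ ⟪y/‖y‖, o'⟫`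
for all `y ∈ 𝒢`. -/
def IsCosineMaximizer (D B : ℕ) (o' ybar : EuclideanSpace ℝ (Fin D)) : Prop :=
  ybar ∈ gridSet D B ∧
    ∀ y ∈ gridSet D B, ⟪‖y‖⁻¹ • y, o'⟫ ≤ ⟪‖ybar‖⁻¹ • ybar, o'⟫

/-- The extended RaBitQ quantized vector `ō = P·ȳ/‖ȳ‖` built from a grid vector `ȳ`. -/
def quantized (D : ℕ) (P : Matrix (Fin D) (Fin D) ℝ) (ybar : EuclideanSpace ℝ (Fin D)) :
    EuclideanSpace ℝ (Fin D) :=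
  Matrix.toEuclideanLin P (‖ybar‖⁻¹ • ybar)

lemma rq_adj {D : ℕ} (P : Matrix (Fin D) (Fin D) ℝ) (x y : EuclideanSpace ℝ (Fin D)) :
    ⟪Matrix.toEuclideanLin P x, y⟫ = ⟪x, Matrix.toEuclideanLin Pᵀ y⟫ := by
  have h := Matrix.toEuclideanLin_conjTranspose_eq_adjoint P
  rw [Matrix.conjTranspose_eq_transpose_of_trivial] at h
  rw [h, LinearMap.adjoint_inner_right]

lemma rq_mul {D : ℕ} (P Q : Matrix (Fin D) (Fin D) ℝ) (x : EuclideanSpace ℝ (Fin D)) :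
    Matrix.toEuclideanLin (P * Q) x = Matrix.toEuclideanLin P (Matrix.toEuclideanLin Q x) := by
  simp [Matrix.toLpLin_mul_same]

lemma rq_inner {D : ℕ} (P : Matrix.orthogonalGroup (Fin D) ℝ) (x y : EuclideanSpace ℝ (Fin D)) :
    ⟪Matrix.toEuclideanLin (P : Matrix (Fin D) (Fin D) ℝ) x,
      Matrix.toEuclideanLin (P : Matrix (Fin D) (Fin D) ℝ) y⟫ = ⟪x, y⟫ := by
  have h : (P : Matrix (Fin D) (Fin D) ℝ)ᵀ * P = 1 :=
    (Matrix.mem_orthogonalGroup_iff' (Fin D) ℝ).1 P.2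
  rw [rq_adj, ← rq_mul, h, Matrix.toLpLin_one]; rfl

lemma rq_norm {D : ℕ} (P : Matrix.orthogonalGroup (Fin D) ℝ) (x : EuclideanSpace ℝ (Fin D)) :
    ‖Matrix.toEuclideanLin (P : Matrix (Fin D) (Fin D) ℝ) x‖ = ‖x‖ := by
  have := rq_inner P x x
  rw [real_inner_self_eq_norm_sq, real_inner_self_eq_norm_sq] at this
  exact (sq_eq_sq₀ (norm_nonneg _) (norm_nonneg _)).1 this

lemma rq_exists {D : ℕ} (f : EuclideanSpace ℝ (Fin D) ≃ₗᵢ[ℝ] EuclideanSpace ℝ (Fin D)) :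
    ∃ Q : Matrix.orthogonalGroup (Fin D) ℝ, ∀ x,
      Matrix.toEuclideanLin (Q : Matrix (Fin D) (Fin D) ℝ) x = f x := by
  set A := Matrix.toEuclideanLin.symm (f.toLinearEquiv.toLinearMap : EuclideanSpace ℝ (Fin D) →ₗ[ℝ] EuclideanSpace ℝ (Fin D)) with hA
  have hf : ∀ x, Matrix.toEuclideanLin A x = f x := by
    intro x; rw [hA, LinearEquiv.apply_symm_apply]; rfl
  refine ⟨⟨A, (Matrix.mem_orthogonalGroup_iff' (Fin D) ℝ).2 ?_⟩, hf⟩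
  apply Matrix.toEuclideanLin.injective
  ext1 x
  refine ext_inner_left ℝ fun y => ?_
  rw [rq_mul, ← rq_adj,
    hf, hf, f.inner_map_map, Matrix.toLpLin_one]; rfl

instance rqBorel (D : ℕ) : BorelSpace (Matrix (Fin D) (Fin D) ℝ) := ⟨rfl⟩

lemma rq_cont {D : ℕ} (x y : EuclideanSpace ℝ (Fin D)) :
    Continuous fun P : Matrix.orthogonalGroup (Fin D) ℝ =>
      ⟪Matrix.toEuclideanLin (P : Matrix (Fin D) (Fin D) ℝ) x, y⟫ := by
  have h : Continuous fun P : Matrix.orthogonalGroup (Fin D) ℝ =>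
      Matrix.toEuclideanLin (P : Matrix (Fin D) (Fin D) ℝ) x := by
    have : Continuous fun P : Matrix (Fin D) (Fin D) ℝ => Matrix.toEuclideanLin P x := by
      simp only [Matrix.toLpLin_apply]
      refine (PiLp.continuous_toLp 2 _).comp ?_
      fun_prop
    exact this.comp continuous_subtype_val
  fun_prop

lemma rq_moment {D : ℕ} (z : EuclideanSpace ℝ (Fin D)) (hz : z ≠ 0) :
    ∀ᶠ t : ℕ in Filter.atTop, ∑ i : Fin D, z i * (t : ℝ) ^ (i : ℕ) ≠ 0 := by
  set p : Polynomial ℝ := ∑ i : Fin D, Polynomial.C (z i) * Polynomial.X ^ (i : ℕ) with hp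
  have hc : ∀ i : Fin D, p.coeff i = z i := by
    intro i
    rw [hp, Polynomial.finsetSum_coeff, Finset.sum_eq_single i]
    · simp
    · intro j _ hj
      rw [Polynomial.coeff_C_mul, Polynomial.coeff_X_pow, if_neg, mul_zero]
      exact fun h => hj (Fin.ext h.symm)
    · simp
  have hp0 : p ≠ 0 := by
    intro h
    apply hz
    ext i
    rw [← hc i, h]; simp
  have hfin : {t : ℕ | p.IsRoot (t : ℝ)}.Finite := by
    have := (Polynomial.finite_setOfPred_isRoot hp0).preimage (f := fun t : ℕ => (t : ℝ))
      (Nat.cast_injective.injOn)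
    exact this
  rw [← Nat.cofinite_eq_atTop]
  filter_upwards [hfin.compl_mem_cofinite] with t ht h
  apply ht
  simp only [Set.mem_ofPred_eq, Polynomial.IsRoot.def, hp, Polynomial.eval_finsetSum]
  simpa using h

lemma rq_null {D : ℕ} (hD : 1 ≤ D) (o w : EuclideanSpace ℝ (Fin D)) (ho : ‖o‖ = 1) (hw : w ≠ 0)
    (μ : Measure (Matrix.orthogonalGroup (Fin D) ℝ))
    (hHaar : μ.IsHaarMeasure) (hProb : IsProbabilityMeasure μ) :
    μ {P | ⟪Matrix.toEuclideanLin (P : Matrix (Fin D) (Fin D) ℝ) w, o⟫ = 0} = 0 := by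
  set U : ℕ → EuclideanSpace ℝ (Fin D) := fun t => WithLp.toLp 2 fun i => (t : ℝ) ^ (i : ℕ) with hU
  have hU0 : ∀ t, U t ≠ 0 := by
    intro t h
    have := congrArg (fun v : EuclideanSpace ℝ (Fin D) => v ⟨0, hD⟩) h
    simp [hU] at this
  set S : ℕ → Set (Matrix.orthogonalGroup (Fin D) ℝ) := fun t =>
    {P | ⟪Matrix.toEuclideanLin (P : Matrix (Fin D) (Fin D) ℝ) w, U t⟫ = 0} with hS
  have hSm : ∀ t, MeasurableSet (S t) := fun t =>
    (isClosed_singleton.preimage (rq_cont w (U t))).measurableSet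
  have heq : ∀ t, μ (S t) =
      μ {P | ⟪Matrix.toEuclideanLin (P : Matrix (Fin D) (Fin D) ℝ) w, o⟫ = 0} := by
    intro t
    set e := ‖U t‖⁻¹ • U t with he
    have hn : ‖U t‖ ≠ 0 := norm_ne_zero_iff.2 (hU0 t)
    have hen : ‖e‖ = ‖o‖ := by
      rw [ho, he, norm_smul, norm_inv, norm_norm, inv_mul_cancel₀ hn]
    obtain ⟨Q, hQ⟩ := rq_exists (Submodule.reflection (Submodule.span ℝ {e - o})ᗮ)
    have hQe := hQ e
    rw [Submodule.reflection_sub hen] at hQe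
    rw [← measure_preimage_mul μ Q {P | ⟪Matrix.toEuclideanLin (P : Matrix (Fin D) (Fin D) ℝ) w, o⟫ = 0}]
    congr 1
    ext P
    simp only [hS, Set.mem_ofPred_eq, Set.mem_preimage, Submonoid.coe_mul, rq_mul]
    rw [← hQe]
    rw [rq_inner, he, real_inner_smul_right]
    simp [hU0 t]
  have hlim := tendsto_measure_of_tendsto_indicator_of_isFiniteMeasure (A := ∅) Filter.atTop μ hSm
    (by
      intro P
      have hz : Matrix.toEuclideanLin (P : Matrix (Fin D) (Fin D) ℝ) w ≠ 0 := by
        rw [← norm_ne_zero_iff, rq_norm]; exact norm_ne_zero_iff.2 hw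
      filter_upwards [rq_moment _ hz] with t ht
      simp only [Set.mem_empty_iff_false, iff_false, hS, Set.mem_ofPred_eq]
      intro h
      apply ht
      rw [← h, PiLp.inner_apply]
      refine Finset.sum_congr rfl fun i _ => ?_
      simp [hU, mul_comm])
  simp only [heq, measure_empty] at hlim
  exact tendsto_const_nhds_iff.1 hlim

lemma rq_grid_finite (D B : ℕ) : (gridSet D B).Finite := by
  refine (Set.finite_range (fun f : Fin D → Fin (2 ^ B) =>
    (WithLp.toLp 2 fun i => -((2 ^ B : ℝ) - 1) / 2 + ((f i : ℕ) : ℝ) :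
      EuclideanSpace ℝ (Fin D)))).subset ?_
  intro y hy
  choose u hu hy using hy
  refine ⟨fun i => ⟨u i, hu i⟩, ?_⟩
  ext i
  simp [hy]

lemma rq_lower {D B : ℕ} (hD : 1 ≤ D) (hB : 1 ≤ B) (v y : EuclideanSpace ℝ (Fin D))
    (hv : ‖v‖ = 1) (h : IsCosineMaximizer D B v y) : 1 / (2 * (D : ℝ)) ≤ ⟪‖y‖⁻¹ • y, v⟫ := by
  obtain ⟨b, rfl⟩ : ∃ b, B = b + 1 := ⟨B - 1, by omega⟩
  set s : EuclideanSpace ℝ (Fin D) :=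
    WithLp.toLp 2 fun i => if 0 ≤ v i then (1 / 2 : ℝ) else -1 / 2 with hs
  have hsg : s ∈ gridSet D (b + 1) := by
    intro i
    have h2 : 1 ≤ 2 ^ b := Nat.one_le_two_pow
    by_cases hi : 0 ≤ v i
    · refine ⟨2 ^ b, by rw [pow_succ]; omega, ?_⟩
      simp only [hs, hi, if_true]
      push_cast; ring
    · refine ⟨2 ^ b - 1, by rw [pow_succ]; omega, ?_⟩
      simp only [hs, hi, if_false]
      push_cast [h2]; ring
  refine le_trans ?_ (h.2 s hsg)
  have hD' : (1 : ℝ) ≤ D := by exact_mod_cast hD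
  have hsn : ‖s‖ ^ 2 = D / 4 := by
    rw [EuclideanSpace.norm_sq_eq]
    have : ∀ i, ‖s i‖ ^ 2 = 1 / 4 := by
      intro i
      simp only [hs, Real.norm_eq_abs, sq_abs]
      split_ifs <;> norm_num
    rw [Finset.sum_congr rfl fun i _ => this i]
    simp; ring
  have hsl : ‖s‖ ≤ D := by
    refine (sq_le_sq₀ (norm_nonneg _) (by positivity)).1 ?_
    rw [hsn]; nlinarith
  have hspos : 0 < ‖s‖ := by
    rcases (norm_nonneg s).eq_or_lt with h0 | h0
    · rw [← h0] at hsn; nlinarith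
    · exact h0
  have hvs : ∑ i, v i ^ 2 = 1 := by
    have := EuclideanSpace.norm_sq_eq v
    simp only [hv, Real.norm_eq_abs, sq_abs] at this
    linarith
  have hin : 1 / 2 ≤ ⟪s, v⟫ := by
    have h1 : (1 / 2 : ℝ) = ∑ i, v i ^ 2 / 2 := by
      rw [← Finset.sum_div, hvs]
    rw [h1, PiLp.inner_apply]
    refine Finset.sum_le_sum fun i _ => ?_
    have hle : v i ^ 2 ≤ 1 := by
      rw [← hvs]
      exact Finset.single_le_sum (f := fun i => v i ^ 2) (fun _ _ => sq_nonneg _) (Finset.mem_univ i)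
    have hab := abs_le.1 ((sq_le_one_iff_abs_le_one _).1 hle)
    simp only [hs, RCLike.inner_apply, conj_trivial]
    split_ifs with hi
    · nlinarith [hab.2]
    · push Not at hi
      nlinarith [hab.1]
  rw [real_inner_smul_left]
  calc 1 / (2 * (D : ℝ)) = (D : ℝ)⁻¹ * (1 / 2) := by field_simp
    _ ≤ ‖s‖⁻¹ * ⟪s, v⟫ := by gcongr

/-- the extended RaBitQ estimator is unbiased: for unit vectors `o, q`, a
Haar-random orthogonal matrix `P`, and any choice `ȳ(P)` of cosine maximizer of `Pᵀo` over the
grid `𝒢`, with `ō = P·ȳ/‖ȳ‖` one has `E_P[⟨ō, q⟩/⟨ō, o⟩] = ⟨o, q⟩`. -/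
theorem extended_rabitq_unbiased (D B : ℕ) (hD : 1 ≤ D) (hB : 1 ≤ B)
    (o q : EuclideanSpace ℝ (Fin D)) (ho : ‖o‖ = 1) (hq : ‖q‖ = 1)
    (μ : Measure (Matrix.orthogonalGroup (Fin D) ℝ))
    (hHaar : μ.IsHaarMeasure) (hProb : IsProbabilityMeasure μ)
    (ybar : Matrix.orthogonalGroup (Fin D) ℝ → EuclideanSpace ℝ (Fin D))
    (hybar : ∀ P : Matrix.orthogonalGroup (Fin D) ℝ,
      IsCosineMaximizer D B
        (Matrix.toEuclideanLin (P : Matrix (Fin D) (Fin D) ℝ)ᵀ o) (ybar P)) :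
    ∫ (P : Matrix.orthogonalGroup (Fin D) ℝ),
        ⟪quantized D (P : Matrix (Fin D) (Fin D) ℝ) (ybar P), q⟫ /
          ⟪quantized D (P : Matrix (Fin D) (Fin D) ℝ) (ybar P), o⟫ ∂μ
      = ⟪o, q⟫ := by
  classical
  have hinner : ∀ (P : Matrix.orthogonalGroup (Fin D) ℝ) (n x : EuclideanSpace ℝ (Fin D)),
    ⟪Matrix.toEuclideanLin (P : Matrix (Fin D) (Fin D) ℝ) n, x⟫ =
      ⟪n, Matrix.toEuclideanLin (P : Matrix (Fin D) (Fin D) ℝ)ᵀ x⟫ := fun P n x => rq_adj _ _ _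
  -- `Pᵀ o` is a unit vector
  have hunit : ∀ P : Matrix.orthogonalGroup (Fin D) ℝ,
      ‖Matrix.toEuclideanLin (P : Matrix (Fin D) (Fin D) ℝ)ᵀ o‖ = 1 := by
    intro P
    have := rq_norm P⁻¹ o
    rw [ho] at this
    exact this
  set d : EuclideanSpace ℝ (Fin D) → EuclideanSpace ℝ (Fin D) := fun y => ‖y‖⁻¹ • y with hd
  have hlow : ∀ P : Matrix.orthogonalGroup (Fin D) ℝ, 1 / (2 * (D : ℝ)) ≤
      ⟪Matrix.toEuclideanLin (P : Matrix (Fin D) (Fin D) ℝ) (d (ybar P)), o⟫ := by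
    intro P
    rw [hinner]
    exact rq_lower hD hB _ _ (hunit P) (hybar P)
  have hDpos : (0 : ℝ) < 1 / (2 * (D : ℝ)) := by
    have : (0 : ℝ) < D := by exact_mod_cast hD
    positivity
  have hfin := (rq_grid_finite D B).image d
  set N := hfin.toFinset with hN
  have hNmem : ∀ n, n ∈ N ↔ ∃ y ∈ gridSet D B, d y = n := by
    intro n; rw [hN, Set.Finite.mem_toFinset]; rfl
  have hgood : ∀ᵐ P : Matrix.orthogonalGroup (Fin D) ℝ ∂μ, ∀ n ∈ N, ∀ n' ∈ N, n ≠ n' →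
      ⟪Matrix.toEuclideanLin (P : Matrix (Fin D) (Fin D) ℝ) (n - n'), o⟫ ≠ 0 := by
    rw [Filter.eventually_all_finset]
    intro n _
    rw [Filter.eventually_all_finset]
    intro n' _
    by_cases hnn : n = n'
    · exact Filter.Eventually.of_forall fun P h => absurd hnn h
    · have := rq_null hD o (n - n') ho (sub_ne_zero.2 hnn) μ hHaar hProb
      rw [measure_eq_zero_iff_ae_notMem] at this
      filter_upwards [this] with P hP _
      exact hP
  have huniq : ∀ P : Matrix.orthogonalGroup (Fin D) ℝ, (∀ n ∈ N, ∀ n' ∈ N, n ≠ n' →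
      ⟪Matrix.toEuclideanLin (P : Matrix (Fin D) (Fin D) ℝ) (n - n'), o⟫ ≠ 0) →
      ∀ n ∈ N, (∀ n' ∈ N, ⟪Matrix.toEuclideanLin (P : Matrix (Fin D) (Fin D) ℝ) n', o⟫ ≤
        ⟪Matrix.toEuclideanLin (P : Matrix (Fin D) (Fin D) ℝ) n, o⟫) → n = d (ybar P) := by
    intro P hP n hn hmax
    by_contra hne
    have hmem : d (ybar P) ∈ N := (hNmem _).2 ⟨_, (hybar P).1, rfl⟩
    apply hP n hn _ hmem hne
    rw [map_sub, inner_sub_left, sub_eq_zero]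
    apply le_antisymm
    · obtain ⟨y, hy, rfl⟩ := (hNmem n).1 hn
      rw [hinner, hinner]
      exact (hybar P).2 y hy
    · exact hmax _ hmem
  set F : Matrix.orthogonalGroup (Fin D) ℝ → ℝ := fun P =>
    ⟪quantized D (P : Matrix (Fin D) (Fin D) ℝ) (ybar P), q⟫ /
          ⟪quantized D (P : Matrix (Fin D) (Fin D) ℝ) (ybar P), o⟫ with hF
  have hFd : ∀ P, F P = ⟪Matrix.toEuclideanLin (P : Matrix (Fin D) (Fin D) ℝ) (d (ybar P)), q⟫ /
      ⟪Matrix.toEuclideanLin (P : Matrix (Fin D) (Fin D) ℝ) (d (ybar P)), o⟫ := fun P => rfl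
  have hmeas : AEStronglyMeasurable F μ := by
    set A : EuclideanSpace ℝ (Fin D) → Set (Matrix.orthogonalGroup (Fin D) ℝ) := fun n =>
      ⋂ n' ∈ N, {P | ⟪Matrix.toEuclideanLin (P : Matrix (Fin D) (Fin D) ℝ) n', o⟫ ≤
        ⟪Matrix.toEuclideanLin (P : Matrix (Fin D) (Fin D) ℝ) n, o⟫} with hA
    have hAm : ∀ n, MeasurableSet (A n) := fun n =>
      Finset.measurableSet_biInter _ fun n' _ =>
        measurableSet_le (rq_cont _ _).measurable (rq_cont _ _).measurable
    have hG : Measurable fun P : Matrix.orthogonalGroup (Fin D) ℝ =>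
        ∑ n ∈ N, (A n).indicator (fun P : Matrix.orthogonalGroup (Fin D) ℝ =>
          ⟪Matrix.toEuclideanLin (P : Matrix (Fin D) (Fin D) ℝ) n, q⟫ /
          ⟪Matrix.toEuclideanLin (P : Matrix (Fin D) (Fin D) ℝ) n, o⟫) P := by
      refine Finset.measurable_sum _ fun n _ => Measurable.indicator ?_ (hAm n)
      exact (rq_cont _ _).measurable.div (rq_cont _ _).measurable
    refine ⟨_, hG.stronglyMeasurable, ?_⟩
    filter_upwards [hgood] with P hP
    rw [Finset.sum_eq_single (d (ybar P)), Set.indicator_of_mem, hFd]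
    · simp only [hA, Set.mem_iInter, Set.mem_ofPred_eq]
      intro n hn
      obtain ⟨y, hy, rfl⟩ := (hNmem n).1 hn
      rw [hinner, hinner]
      exact (hybar P).2 y hy
    · intro n hn hne
      refine Set.indicator_of_notMem (fun hmem => hne (huniq P hP n hn ?_)) _
      simpa only [hA, Set.mem_iInter, Set.mem_ofPred_eq] using hmem
    · exact fun h => absurd ((hNmem _).2 ⟨_, (hybar P).1, rfl⟩) h
  have hint : Integrable F μ := by
    refine Integrable.of_bound hmeas (2 * (D : ℝ)) (Filter.Eventually.of_forall fun P => ?_)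
    rw [hFd, norm_div, div_le_iff₀ (norm_pos_iff.2 (hDpos.trans_le (hlow P)).ne')]
    have h1 : ‖⟪Matrix.toEuclideanLin (P : Matrix (Fin D) (Fin D) ℝ) (d (ybar P)), q⟫‖ ≤ 1 := by
      refine (norm_inner_le_norm _ _).trans ?_
      rw [rq_norm, hq, mul_one, hd]
      simp only [norm_smul, norm_inv, norm_norm]
      exact inv_mul_le_one
    have h2 := (hlow P).trans (le_abs_self _)
    rw [← Real.norm_eq_abs, div_le_iff₀ (by simpa using hDpos)] at h2
    linarith
  obtain ⟨R, hR⟩ := rq_exists (Submodule.reflection (Submodule.span ℝ {o}))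
  have hRo : Matrix.toEuclideanLin (R : Matrix (Fin D) (Fin D) ℝ) o = o := by
    rw [hR]
    exact Submodule.reflection_mem_subspace_eq_self (Submodule.mem_span_singleton_self o)
  have hRq : Matrix.toEuclideanLin (R : Matrix (Fin D) (Fin D) ℝ) q = (2 * ⟪o, q⟫) • o - q := by
    rw [hR, Submodule.reflection_singleton_apply, ho]
    simp [mul_smul, two_smul]
  have hRR : ∀ x, Matrix.toEuclideanLin (R : Matrix (Fin D) (Fin D) ℝ)
      (Matrix.toEuclideanLin (R : Matrix (Fin D) (Fin D) ℝ) x) = x := by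
    intro x; rw [hR, hR, Submodule.reflection_reflection]
  have hRs : ∀ x y, ⟪Matrix.toEuclideanLin (R : Matrix (Fin D) (Fin D) ℝ) x, y⟫ =
      ⟪x, Matrix.toEuclideanLin (R : Matrix (Fin D) (Fin D) ℝ) y⟫ := by
    intro x y
    rw [← rq_inner R, hRR]
  have hmulo : ∀ (P : Matrix.orthogonalGroup (Fin D) ℝ) n,
      ⟪Matrix.toEuclideanLin ((R * P : Matrix.orthogonalGroup (Fin D) ℝ) :
        Matrix (Fin D) (Fin D) ℝ) n, o⟫ =
      ⟪Matrix.toEuclideanLin (P : Matrix (Fin D) (Fin D) ℝ) n, o⟫ := by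
    intro P n
    rw [Submonoid.coe_mul, rq_mul, hRs, hRo]
  have hflip : ∀ᵐ P : Matrix.orthogonalGroup (Fin D) ℝ ∂μ, F (R * P) = 2 * ⟪o, q⟫ - F P := by
    filter_upwards [hgood] with P hP
    have hdir : d (ybar (R * P)) = d (ybar P) := by
      refine huniq P hP _ ((hNmem _).2 ⟨_, (hybar (R * P)).1, rfl⟩) fun n' hn' => ?_
      obtain ⟨y, hy, rfl⟩ := (hNmem n').1 hn'
      rw [← hmulo P, ← hmulo P (d (ybar (R * P))), hinner, hinner]
      exact (hybar (R * P)).2 y hy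
    have hne := (hDpos.trans_le (hlow P)).ne'
    rw [hFd, hFd, hdir, hmulo, Submonoid.coe_mul, rq_mul, hRs, hRq, inner_sub_right,
      real_inner_smul_right, sub_div, mul_div_assoc, div_self hne, mul_one]
  have hinv := integral_mul_left_eq_self (μ := μ) F R
  rw [integral_congr_ae hflip, integral_sub (integrable_const _) hint, integral_const] at hinv
  simp only [probReal_univ, one_smul] at hinv
  linarith
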